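/- arXiv:1909.05270 — 2 statements merged into one kernel-verified Lean document; each statement's English description precedes it below -/
import Mathlib

section
/- Reachability in the canonical form coincides with reachability in the full dependence graph: for a circuit c : Fin n → M and all labels i j : Fin n, Relation.TransGen (CanonEdge c) i j ↔ Relation.TransGen (Dep c) i j. -/
/-- One step of interchanging two adjacent commuting gates. -/
def Step {M : Type*} [Monoid M] {n : ℕ} (c : Fin n → M)
    (σ σ' : Equiv.Perm (Fin n)) : Prop :=
  ∃ k k' : Fin n, (k' : ℕ) = (k : ℕ) + 1 ∧ σ' = σ * Equiv.swap k k' ∧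
    Commute (c (σ k)) (c (σ k'))

/-- σ is an admissible reordering of the circuit c. -/
def Admissible {M : Type*} [Monoid M] {n : ℕ} (c : Fin n → M)
    (σ : Equiv.Perm (Fin n)) : Prop :=
  Relation.ReflTransGen (Step c) 1 σ

/-- The dependence relation of a circuit. -/
def Dep {M : Type*} [Monoid M] {n : ℕ} (c : Fin n → M) (i j : Fin n) : Prop :=
  i < j ∧ ¬ Commute (c i) (c j)

/-- The edge relation of the canonical form of a circuit. -/
def CanonEdge {M : Type*} [Monoid M] {n : ℕ} (c : Fin n → M) (i j : Fin n) : Prop :=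
  ¬ Commute (c i) (c j) ∧
    ∃ σ : Equiv.Perm (Fin n), Admissible c σ ∧ ((σ⁻¹ j : Fin n) : ℕ) = ((σ⁻¹ i : Fin n) : ℕ) + 1

/-- Interchanging two adjacent positions preserves the order of every other pair. -/
theorem Fin.swap_adjacent_lt_swap_adjacent {n : ℕ} {k k' a b : Fin n}
    (hk : (k' : ℕ) = (k : ℕ) + 1) (hab : a < b) (hne : ¬ (a = k ∧ b = k')) :
    Equiv.swap k k' a < Equiv.swap k k' b := by
  simp only [Equiv.swap_apply_def, Fin.ext_iff, Fin.lt_def] at *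
  split_ifs <;> omega

/-- Admissible reorderings keep the relative order of any two dependent gates. -/
theorem Admissible.inv_lt_inv {M : Type*} [Monoid M] {n : ℕ} {c : Fin n → M}
    {σ : Equiv.Perm (Fin n)} (h : Admissible c σ) {i j : Fin n} (hij : Dep c i j) :
    σ⁻¹ i < σ⁻¹ j := by
  induction h with
  | refl => simpa using hij.1
  | @tail τ _ _ hstep ih =>
    obtain ⟨k, k', hk, rfl, hcomm⟩ := hstep
    obtain ⟨a, rfl⟩ := τ.surjective i
    obtain ⟨b, rfl⟩ := τ.surjective j
    have hab : a < b := by simpa using ih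
    have hne : ¬ (a = k ∧ b = k') := by
      rintro ⟨rfl, rfl⟩
      exact hij.2 hcomm
    simpa using Fin.swap_adjacent_lt_swap_adjacent hk hab hne

/-- A permutation of `Fin n` without descents at adjacent positions is the identity. -/
theorem Equiv.Perm.eq_one_of_forall_adjacent_le {n : ℕ} {σ : Equiv.Perm (Fin n)}
    (h : ∀ k k' : Fin n, (k' : ℕ) = (k : ℕ) + 1 → σ k ≤ σ k') : σ = 1 := by
  have hmono : Monotone σ := by
    cases n with
    | zero => exact fun a => a.elim0
    | succ n => exact Fin.monotone_iff_le_succ.2 fun a => h _ _ (by simp)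
  have hsort : ∀ τ : Equiv.Perm (Fin n), Monotone τ → τ = Tuple.sort (id : Fin n → Fin n) :=
    fun τ hτ => Tuple.eq_sort_iff.2
      ⟨hτ, fun a b hab heq => absurd (τ.injective heq) hab.ne⟩
  rw [hsort σ hmono, hsort 1 monotone_id]

/-- Every reordering that respects the dependence relation is admissible. -/
theorem admissible_of_forall_dep {M : Type*} [Monoid M] {n : ℕ} {c : Fin n → M}
    (σ : Equiv.Perm (Fin n)) (h : ∀ i j, Dep c i j → σ⁻¹ i < σ⁻¹ j) : Admissible c σ := by
  have hwf : WellFounded fun τ τ' : Equiv.Perm (Fin n) =>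
      toLex (τ : Fin n → Fin n) < toLex (τ' : Fin n → Fin n) :=
    InvImage.wf (fun τ : Equiv.Perm (Fin n) => toLex (τ : Fin n → Fin n))
      (Finite.wellFounded_of_trans_of_irrefl (α := Lex (Fin n → Fin n)) (· < ·))
  induction σ using hwf.induction with
  | _ σ ih =>
  by_cases hdesc : ∀ k k' : Fin n, (k' : ℕ) = (k : ℕ) + 1 → σ k ≤ σ k'
  · rw [Equiv.Perm.eq_one_of_forall_adjacent_le hdesc]
    exact Relation.ReflTransGen.refl
  push Not at hdesc
  obtain ⟨k, k', hk, hlt⟩ := hdesc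
  have hkk' : k < k' := by rw [Fin.lt_def]; omega
  have hcomm : Commute (c (σ k')) (c (σ k)) := by
    by_contra hnc
    have := h _ _ ⟨hlt, hnc⟩
    simp only [Equiv.Perm.inv_def, Equiv.symm_apply_apply] at this
    exact absurd this hkk'.not_gt
  refine Relation.ReflTransGen.tail (b := σ * Equiv.swap k k') (ih _ ?_ ?_)
    ⟨k, k', hk, by simp [mul_assoc], by simpa using hcomm⟩
  · exact Pi.lex_desc hkk'.le hlt
  · intro i j hij
    have hpos := h i j hij
    obtain ⟨a, rfl⟩ := σ.surjective i
    obtain ⟨b, rfl⟩ := σ.surjective j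
    have hne : ¬ (a = k ∧ b = k') := by
      rintro ⟨rfl, rfl⟩
      exact hij.2 hcomm.symm
    simpa using Fin.swap_adjacent_lt_swap_adjacent hk (by simpa using hpos) hne

theorem lt_of_transGen_dep {M : Type*} [Monoid M] {n : ℕ} {c : Fin n → M} {i j : Fin n}
    (h : Relation.TransGen (Dep c) i j) : i < j :=
  h.trans_induction_on And.left fun _ _ => lt_trans

theorem CanonEdge.dep {M : Type*} [Monoid M] {n : ℕ} {c : Fin n → M} {i j : Fin n}
    (h : CanonEdge c i j) : Dep c i j := by
  obtain ⟨hnc, σ, hσ, hadj⟩ := h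
  refine ⟨?_, hnc⟩
  rcases lt_trichotomy i j with hlt | rfl | hgt
  · exact hlt
  · omega
  · have := hσ.inv_lt_inv ⟨hgt, fun hc => hnc hc.symm⟩
    rw [Fin.lt_def] at this
    omega

/-- A dependence that does not factor through an intermediate gate is an edge of the canonical
form. -/
theorem Dep.canonEdge {M : Type*} [Monoid M] {n : ℕ} {c : Fin n → M} {i j : Fin n}
    (h : Dep c i j) (hcov : ∀ l, Relation.TransGen (Dep c) i l → ¬ Dep c l j) :
    CanonEdge c i j := by
  classical
  let key : Fin n → ℕ := fun l =>
    if l = i then 1 else if l = j then 2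
    else if l < j ∧ ¬ Relation.TransGen (Dep c) i l then 0 else 3
  have hkey : ∀ a b, Dep c a b → key a ≤ key b := by
    intro a b hab
    have hlt := hab.1
    have hij := h.1
    have hreach : Relation.TransGen (Dep c) i a → Relation.TransGen (Dep c) i b :=
      fun ha => ha.tail hab
    have hstart : a = i → Relation.TransGen (Dep c) i b := by
      rintro rfl
      exact .single hab
    have hend : b = j → ¬ Relation.TransGen (Dep c) i a := by
      rintro rfl ha
      exact hcov a ha hab
    have hgt : Relation.TransGen (Dep c) i a → i < a := lt_of_transGen_dep
    simp only [key]
    split_ifs <;> grind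
  let σ := Tuple.sort key
  obtain ⟨hmono, hstable⟩ := Tuple.eq_sort_iff.1 (rfl : σ = Tuple.sort key)
  refine ⟨h.2, σ, admissible_of_forall_dep σ fun a b hab => ?_, ?_⟩
  · obtain ⟨p, rfl⟩ := σ.surjective a
    obtain ⟨q, rfl⟩ := σ.surjective b
    simp only [Equiv.Perm.inv_def, Equiv.symm_apply_apply]
    by_contra hle
    rcases (not_lt.1 hle).lt_or_eq with hqp | rfl
    · exact (hstable q p hqp (le_antisymm (hmono hqp.le) (hkey _ _ hab))).not_gt hab.1
    · exact hab.1.false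
  · have hi : key i = 1 := by simp [key]
    have hj : key j = 2 := by simp [key, h.1.ne']
    have honly : ∀ l, 1 ≤ key l → key l ≤ 2 → l = i ∨ l = j := by
      intro l
      simp only [key]
      split_ifs <;> simp_all
    obtain ⟨p, hp⟩ := σ.surjective i
    obtain ⟨q, hq⟩ := σ.surjective j
    have hpq : p < q := hmono.reflect_lt (by simp [hp, hq, hi, hj])
    rw [Equiv.Perm.inv_eq_iff_eq.2 hp.symm, Equiv.Perm.inv_eq_iff_eq.2 hq.symm]
    by_contra hne
    rw [Fin.lt_def] at hpq
    let r : Fin n := ⟨p + 1, by omega⟩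
    have hpr : p < r := by simp [r, Fin.lt_def]
    have hrq : r < q := by simp only [r, Fin.lt_def]; omega
    have h₁ : key (σ p) ≤ key (σ r) := hmono hpr.le
    have h₂ : key (σ r) ≤ key (σ q) := hmono hrq.le
    rw [hp, hi] at h₁
    rw [hq, hj] at h₂
    rcases honly _ h₁ h₂ with hr | hr
    · exact hpr.ne' (σ.injective (hr.trans hp.symm))
    · exact hrq.ne (σ.injective (hr.trans hq.symm))

/-- Dependence paths are realised by paths in the canonical form. -/
theorem transGen_canonEdge_of_transGen_dep {M : Type*} [Monoid M] {n : ℕ} {c : Fin n → M}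
    {i j : Fin n} (h : Relation.TransGen (Dep c) i j) : Relation.TransGen (CanonEdge c) i j := by
  induction hd : (j : ℕ) - (i : ℕ) using Nat.strong_induction_on generalizing i j with
  | _ d ih =>
  by_cases hcov : ∀ l, Relation.TransGen (Dep c) i l → ¬ Dep c l j
  · cases h with
    | single h => exact .single (h.canonEdge hcov)
    | tail hil hlj => exact absurd hlj (hcov _ hil)
  · push Not at hcov
    obtain ⟨l, hil, hlj⟩ := hcov
    have hil_lt := Fin.lt_def.1 (lt_of_transGen_dep hil)
    have hlj_lt := Fin.lt_def.1 hlj.1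
    exact (ih _ (by omega) hil rfl).trans (ih _ (by omega) (.single hlj) rfl)

theorem canon_reachability_eq_dep_reachability {M : Type*} [Monoid M] {n : ℕ}
    (c : Fin n → M) (i j : Fin n) :
    Relation.TransGen (CanonEdge c) i j ↔ Relation.TransGen (Dep c) i j := by
  exact ⟨Relation.TransGen.mono (fun _ _ => CanonEdge.dep) i j,
    transGen_canonEdge_of_transGen_dep⟩
end

section
/- Invariance of dependence reachability under interchanging commuting gates: let σ be an admissible reordering of the circuit c : Fin n → M and let c' = c ∘ σ be the commuted circuit. Then for all labels i j : Fin n, Relation.TransGen (Dep c') (σ⁻¹ i) (σ⁻¹ j) ↔ Relation.TransGen (Dep c) i j; i.e. the successor relation between gates, expressed in original labels, is the same for c and for any circuit obtained from c by pairwise interchanging commuting gates. -/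
theorem swap_lt_swap_iff_of_adjacent {n : ℕ} {k k' : Fin n} (hk : (k' : ℕ) = (k : ℕ) + 1)
    {a b : Fin n} (h : ¬ (a = k ∧ b = k')) (h' : ¬ (a = k' ∧ b = k)) :
    Equiv.swap k k' a < Equiv.swap k k' b ↔ a < b := by
  simp only [Equiv.swap_apply_def]
  simp only [Fin.ext_iff] at h h' ⊢
  split_ifs <;> simp only [Fin.lt_def] <;> omega

theorem dep_comp_inv_iff_of_step {M : Type*} [Monoid M] {n : ℕ} {c : Fin n → M}
    {σ σ' : Equiv.Perm (Fin n)} (h : Step c σ σ') (i j : Fin n) :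
    Dep (c ∘ σ') (σ'⁻¹ i) (σ'⁻¹ j) ↔ Dep (c ∘ σ) (σ⁻¹ i) (σ⁻¹ j) := by
  obtain ⟨k, k', hk, rfl, hc⟩ := h
  obtain ⟨a, rfl⟩ := σ.surjective i
  obtain ⟨b, rfl⟩ := σ.surjective j
  simp only [Dep, mul_inv_rev, Equiv.swap_inv, Equiv.Perm.mul_apply, Function.comp_apply,
    Equiv.Perm.coe_inv, Equiv.symm_apply_apply, Equiv.swap_apply_self]
  refine and_congr_left fun hab => swap_lt_swap_iff_of_adjacent hk ?_ ?_
  · rintro ⟨rfl, rfl⟩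
    exact hab hc
  · rintro ⟨rfl, rfl⟩
    exact hab hc.symm

/-- The dependence relation, expressed in original labels, is unchanged by an admissible
reordering. -/
theorem dep_comp_inv_iff_of_admissible {M : Type*} [Monoid M] {n : ℕ} {c : Fin n → M}
    {σ : Equiv.Perm (Fin n)} (h : Admissible c σ) (i j : Fin n) :
    Dep (c ∘ σ) (σ⁻¹ i) (σ⁻¹ j) ↔ Dep c i j := by
  induction h with
  | refl => rfl
  | tail _ hs ih => exact (dep_comp_inv_iff_of_step hs i j).trans ih

theorem dep_reachability_invariant {M : Type*} [Monoid M] {n : ℕ}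
    (c : Fin n → M) (σ : Equiv.Perm (Fin n)) (hσ : Admissible c σ)
    (i j : Fin n) :
    Relation.TransGen (Dep (c ∘ σ)) (σ⁻¹ i) (σ⁻¹ j) ↔
      Relation.TransGen (Dep c) i j := by
  constructor
  · intro h
    have := Relation.TransGen.lift (p := Dep c) σ (fun a b hab =>
      (dep_comp_inv_iff_of_admissible hσ (σ a) (σ b)).1 (by simpa using hab)) _ _ h
    simpa [Function.onFun] using this
  · exact fun h => h.lift _ fun a b => (dep_comp_inv_iff_of_admissible hσ a b).2
end
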